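/- Let n ≥ 1, let Ω ⊂ ℝⁿ be open and bounded, and let E ⊂ ℝⁿ be measurable with Per_{s₀}(E,Ω) < ∞ for some s₀ ∈ (0,1/2). Assume there exist c* > 0 and η > 2s₀ such that 𝓛ⁿ(D_r^Ω(Ω^c)) ≤ c* · min{r^η, 1} for all r ∈ [0,1]. If 𝓛ⁿ(E ∩ Ω) ≠ 𝓛ⁿ(E^c ∩ Ω), then the limit lim_{s→0⁺} s · Per_s(E,Ω) exists if and only if the limit Ξ_E = lim_{s→0⁺} s · Λ_E(x, r, s) exists for some (hence all) x ∈ ℝⁿ, r > 0; and in that case Ξ_E = (lim_{s→0⁺} s · Per_s(E,Ω) − 2 𝓛ⁿ(E ∩ Ω)) / (2 (𝓛ⁿ(E^c ∩ Ω) − 𝓛ⁿ(E ∩ Ω))). -/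

import Mathlib

open MeasureTheory Real Filter Topology Set
open scoped ENNReal

/-- The classical heat kernel on `ℝⁿ`. -/
noncomputable def heatKernel (n : ℕ) (t : ℝ) (x y : EuclideanSpace ℝ (Fin n)) : ℝ :=
  (4 * π * t) ^ (-(n : ℝ) / 2) * Real.exp (-‖x - y‖ ^ 2 / (4 * t))

/-- `L_s(A,B) = ∫₀^∞ t^{-(1+s)} ∫_A ∫_B p_t(x,y) dy dx dt`. -/
noncomputable def Lfun (n : ℕ) (s : ℝ) (A B : Set (EuclideanSpace ℝ (Fin n))) : ℝ≥0∞ :=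
  ∫⁻ t in Set.Ioi (0:ℝ), ENNReal.ofReal (t ^ (-(1 + s))) *
    ∫⁻ x in A, ∫⁻ y in B, ENNReal.ofReal (heatKernel n t x y)

/-- The relative `s`-perimeter
`Per_s(E,Ω) = 2[L_s(E∩Ω, Eᶜ∩Ω) + L_s(E∩Ω, Eᶜ∩Ωᶜ) + L_s(E∩Ωᶜ, Eᶜ∩Ω)]`. -/
noncomputable def sPer (n : ℕ) (s : ℝ) (E Ω : Set (EuclideanSpace ℝ (Fin n))) : ℝ≥0∞ :=
  2 * (Lfun n s (E ∩ Ω) (Eᶜ ∩ Ω) + Lfun n s (E ∩ Ω) (Eᶜ ∩ Ωᶜ) + Lfun n s (E ∩ Ωᶜ) (Eᶜ ∩ Ω))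

/-- `Λ_E(x,r,s) = ∫₁^∞ t^{-(1+s)} ∫_{E \ B(x,r)} p_t(x,y) dy dt`. -/
noncomputable def LambdaE (n : ℕ) (E : Set (EuclideanSpace ℝ (Fin n)))
    (x : EuclideanSpace ℝ (Fin n)) (r s : ℝ) : ℝ≥0∞ :=
  ∫⁻ t in Set.Ioi (1:ℝ), ENNReal.ofReal (t ^ (-(1 + s))) *
    ∫⁻ y in E \ Metric.ball x r, ENNReal.ofReal (heatKernel n t x y)

/-- The inner collar `D_r^Ω(Ωᶜ) = {x ∈ Ω : dist(x, Ωᶜ) ≤ r}`. -/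
def innerCollar (n : ℕ) (Ω : Set (EuclideanSpace ℝ (Fin n))) (r : ℝ) :
    Set (EuclideanSpace ℝ (Fin n)) :=
  {x | x ∈ Ω ∧ Metric.infDist x Ωᶜ ≤ r}

local notation "𝔼" n => EuclideanSpace ℝ (Fin n)

section HeatKernel

variable {n : ℕ}

lemma heatKernel_nonneg {t : ℝ} (ht : 0 < t) (x y : 𝔼 n) : 0 ≤ heatKernel n t x y := by
  unfold heatKernel
  positivity

lemma heatKernel_symm (t : ℝ) (x y : 𝔼 n) : heatKernel n t x y = heatKernel n t y x := by
  unfold heatKernel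
  rw [norm_sub_rev]

lemma measurable_heatKernel :
    Measurable fun p : (ℝ × (𝔼 n)) × (𝔼 n) => heatKernel n p.1.1 p.1.2 p.2 := by
  unfold heatKernel
  fun_prop

lemma continuous_heatKernel (t : ℝ) (z : 𝔼 n) : Continuous fun x => heatKernel n t x z := by
  unfold heatKernel
  fun_prop

lemma measurable_heatKernel_right (t : ℝ) (x : 𝔼 n) : Measurable (heatKernel n t x) :=
  measurable_heatKernel.comp
    ((measurable_const (a := (t, x))).prodMk (measurable_id (α := 𝔼 n)))

lemma heatKernel_le {t : ℝ} (ht : 0 < t) (x y : 𝔼 n) :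
    heatKernel n t x y ≤ (4 * π * t) ^ (-(n : ℝ) / 2) := by
  unfold heatKernel
  refine mul_le_of_le_one_right (by positivity) (Real.exp_le_one_iff.2 ?_)
  rw [neg_div]
  exact neg_nonpos.2 (by positivity)

lemma integral_heatKernel {t : ℝ} (ht : 0 < t) (x : 𝔼 n) : ∫ y, heatKernel n t x y = 1 := by
  unfold heatKernel
  rw [integral_sub_left_eq_self
    (fun v : 𝔼 n => (4 * π * t) ^ (-(n : ℝ) / 2) * Real.exp (-‖v‖ ^ 2 / (4 * t))) volume x,
    integral_const_mul]
  have h := GaussianFourier.integral_rexp_neg_mul_sq_norm (V := 𝔼 n)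
    (b := (4 * t)⁻¹) (by positivity)
  have h' : ∀ v : 𝔼 n, -‖v‖ ^ 2 / (4 * t) = -(4 * t)⁻¹ * ‖v‖ ^ 2 := fun v => by ring
  simp_rw [h', h, finrank_euclideanSpace_fin, div_inv_eq_mul]
  rw [show π * (4 * t) = 4 * π * t by ring, ← Real.rpow_add (by positivity),
    neg_div, neg_add_cancel, Real.rpow_zero]

lemma integrable_heatKernel {t : ℝ} (ht : 0 < t) (x : 𝔼 n) : Integrable (heatKernel n t x) :=
  integrable_of_integral_eq_one (integral_heatKernel ht x)

lemma heatKernel_scaling {t : ℝ} (ht : 0 < t) (x y : 𝔼 n) :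
    heatKernel n t x y =
      (√t ^ n)⁻¹ * heatKernel n 1 ((√t)⁻¹ • x) ((√t)⁻¹ • y) := by
  unfold heatKernel
  have h1 : (√t ^ n)⁻¹ = t ^ (-(n : ℝ) / 2) := by
    rw [Real.sqrt_eq_rpow, ← Real.rpow_natCast, ← Real.rpow_mul ht.le, ← Real.rpow_neg ht.le]
    congr 1
    ring
  rw [h1, ← smul_sub, norm_smul, mul_pow, norm_inv, inv_pow, Real.norm_eq_abs, sq_abs,
    Real.sq_sqrt ht.le, Real.mul_rpow (by positivity) ht.le]
  have h2 : -‖x - y‖ ^ 2 / (4 * t) = -(t⁻¹ * ‖x - y‖ ^ 2) / (4 * 1) := by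
    field_simp
  rw [h2, mul_one (4 * π)]
  ring

/-- Heat kernels with distinct base points merge in `L¹` for large times. -/
lemma tendsto_integral_abs_heatKernel_sub (x x' : 𝔼 n) :
    Tendsto (fun t => ∫ y, |heatKernel n t x y - heatKernel n t x' y|) atTop (𝓝 0) := by
  have hscale : ∀ᶠ t : ℝ in atTop,
      ∫ z, |heatKernel n 1 ((√t)⁻¹ • x) z - heatKernel n 1 ((√t)⁻¹ • x') z| =
        ∫ y, |heatKernel n t x y - heatKernel n t x' y| := by
    filter_upwards [eventually_gt_atTop 0] with t ht
    have hR : 0 < √t ^ n := by positivity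
    simp_rw [heatKernel_scaling ht, ← mul_sub, abs_mul, abs_of_pos (inv_pos.2 hR)]
    rw [integral_const_mul, Measure.integral_comp_inv_smul volume
      (fun z => |heatKernel n 1 ((√t)⁻¹ • x) z - heatKernel n 1 ((√t)⁻¹ • x') z|),
      finrank_euclideanSpace_fin, abs_of_pos hR, smul_eq_mul, inv_mul_cancel_left₀ hR.ne']
  refine Tendsto.congr' hscale ?_
  have hlim : ∀ w : 𝔼 n, Tendsto (fun t : ℝ => (√t)⁻¹ • w) atTop (𝓝 0) := fun w => by
    simpa using (tendsto_inv_atTop_zero.comp Real.tendsto_sqrt_atTop).smul_const w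
  have hsmall : ∀ w : 𝔼 n, ∀ᶠ t : ℝ in atTop, ‖(√t)⁻¹ • w‖ ≤ 1 := fun w => by
    filter_upwards [(hlim w).eventually (Metric.closedBall_mem_nhds 0 one_pos)] with t ht
    simpa using ht
  have hdom : ∀ w z : 𝔼 n, ‖w‖ ≤ 1 →
      heatKernel n 1 w z ≤
        (4 * π * 1) ^ (-(n : ℝ) / 2) * (Real.exp (1 / 4) * Real.exp (-(1 / 8) * ‖z‖ ^ 2)) := by
    intro w z hw
    unfold heatKernel
    gcongr
    rw [← Real.exp_add, Real.exp_le_exp]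
    have h1 : ‖z‖ ≤ ‖w‖ + ‖w - z‖ := by
      rw [norm_sub_rev]
      simpa using norm_add_le w (z - w)
    have h2 : ‖z‖ ^ 2 ≤ (1 + ‖w - z‖) ^ 2 := by
      gcongr
      linarith
    nlinarith [sq_nonneg (1 - ‖w - z‖)]
  have hgauss : Integrable fun z : 𝔼 n => Real.exp (-(1 / 8) * ‖z‖ ^ 2) := by
    have h := (GaussianFourier.integral_rexp_neg_mul_sq_norm (V := 𝔼 n) (b := 1 / 8)
      (by norm_num))
    by_contra hcon
    rw [integral_undef hcon] at h
    have : (0 : ℝ) < (π / (1 / 8)) ^ ((Module.finrank ℝ (𝔼 n) : ℝ) / 2) := by positivity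
    exact this.ne h
  have key := tendsto_integral_filter_of_dominated_convergence (μ := volume) (l := atTop)
    (F := fun t z => |heatKernel n 1 ((√t)⁻¹ • x) z - heatKernel n 1 ((√t)⁻¹ • x') z|)
    (f := fun _ : 𝔼 n => (0 : ℝ))
    (fun z => (4 * π * 1) ^ (-(n : ℝ) / 2) *
      (Real.exp (1 / 4) * Real.exp (-(1 / 8) * ‖z‖ ^ 2)))
    (Eventually.of_forall fun t => ((measurable_heatKernel_right _ _).sub
      (measurable_heatKernel_right _ _)).abs.aestronglyMeasurable)
    ?_ ((hgauss.const_mul _).const_mul _) (ae_of_all _ fun z => ?_)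
  · simpa using key
  · filter_upwards [hsmall x, hsmall x'] with t h1 h2
    refine ae_of_all _ fun z => ?_
    have h3 := heatKernel_nonneg one_pos ((√t)⁻¹ • x) z
    have h4 := heatKernel_nonneg one_pos ((√t)⁻¹ • x') z
    rw [Real.norm_eq_abs, abs_abs, abs_le]
    constructor <;> linarith [hdom _ z h1, hdom _ z h2]
  · have h : ∀ w : 𝔼 n, Tendsto (fun t : ℝ => heatKernel n 1 ((√t)⁻¹ • w) z) atTop
        (𝓝 (heatKernel n 1 0 z)) := fun w =>
      ((continuous_heatKernel 1 z).tendsto 0).comp (hlim w)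
    simpa using ((h x).sub (h x')).abs

/-- The heat content `∫_S p_t(x,y) dy`. -/
noncomputable def heatContent (n : ℕ) (S : Set (𝔼 n)) (t : ℝ) (x : 𝔼 n) : ℝ :=
  ∫ y in S, heatKernel n t x y

lemma measurable_heatContent (S : Set (𝔼 n)) :
    Measurable fun p : ℝ × (𝔼 n) => heatContent n S p.1 p.2 :=
  (StronglyMeasurable.integral_prod_right (ν := volume.restrict S)
    (f := fun (p : ℝ × (𝔼 n)) y => heatKernel n p.1 p.2 y)
    measurable_heatKernel.stronglyMeasurable).measurable

lemma heatContent_nonneg {t : ℝ} (ht : 0 < t) (S : Set (𝔼 n)) (x : 𝔼 n) :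
    0 ≤ heatContent n S t x :=
  integral_nonneg fun _ => heatKernel_nonneg ht _ _

lemma heatContent_le_one {t : ℝ} (ht : 0 < t) (S : Set (𝔼 n)) (x : 𝔼 n) :
    heatContent n S t x ≤ 1 := by
  rw [← integral_heatKernel ht x]
  exact setIntegral_le_integral (integrable_heatKernel ht x)
    (ae_of_all _ fun _ => heatKernel_nonneg ht _ _)

lemma abs_heatContent_le_one {t : ℝ} (ht : 0 < t) (S : Set (𝔼 n)) (x : 𝔼 n) :
    |heatContent n S t x| ≤ 1 := by
  rw [abs_of_nonneg (heatContent_nonneg ht S x)]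
  exact heatContent_le_one ht S x

lemma ofReal_heatContent {t : ℝ} (ht : 0 < t) (S : Set (𝔼 n)) (x : 𝔼 n) :
    ENNReal.ofReal (heatContent n S t x) = ∫⁻ y in S, ENNReal.ofReal (heatKernel n t x y) :=
  ofReal_integral_eq_lintegral_ofReal (integrable_heatKernel ht x).integrableOn
    (ae_of_all _ fun _ => heatKernel_nonneg ht _ _)

lemma heatContent_union {t : ℝ} (ht : 0 < t) {S T : Set (𝔼 n)} (hST : Disjoint S T)
    (hT : MeasurableSet T) (x : 𝔼 n) :
    heatContent n (S ∪ T) t x = heatContent n S t x + heatContent n T t x :=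
  setIntegral_union hST hT (integrable_heatKernel ht x).integrableOn
    (integrable_heatKernel ht x).integrableOn

lemma heatContent_univ {t : ℝ} (ht : 0 < t) (x : 𝔼 n) : heatContent n univ t x = 1 := by
  rw [heatContent, setIntegral_univ, integral_heatKernel ht]

lemma tendsto_heatContent_sub (S : Set (𝔼 n)) (x x' : 𝔼 n) :
    Tendsto (fun t => heatContent n S t x - heatContent n S t x') atTop (𝓝 0) := by
  refine squeeze_zero_norm' ?_ (tendsto_integral_abs_heatKernel_sub x x')
  filter_upwards [eventually_gt_atTop 0] with t ht
  have hi := (integrable_heatKernel ht x).sub (integrable_heatKernel ht x')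
  rw [heatContent, heatContent, ← integral_sub (integrable_heatKernel ht x).integrableOn
    (integrable_heatKernel ht x').integrableOn]
  exact (norm_integral_le_integral_norm _).trans
    (setIntegral_le_integral hi.norm (ae_of_all _ fun _ => norm_nonneg _))

lemma tendsto_heatContent_of_volume_ne_top (hn : 1 ≤ n) {S : Set (𝔼 n)} (hS : volume S ≠ ⊤)
    (x : 𝔼 n) : Tendsto (fun t => heatContent n S t x) atTop (𝓝 0) := by
  have hlim : Tendsto (fun t : ℝ => (4 * π * t) ^ (-(n : ℝ) / 2) * volume.real S)
      atTop (𝓝 0) := by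
    have hn' : (0 : ℝ) < n / 2 := by positivity
    have h := (tendsto_rpow_neg_atTop hn').comp
      (tendsto_id.const_mul_atTop (show 0 < 4 * π by positivity))
    simpa [Function.comp_def, neg_div] using h.mul_const (volume.real S)
  refine squeeze_zero_norm' ?_ hlim
  filter_upwards [eventually_gt_atTop 0] with t ht
  refine norm_setIntegral_le_of_norm_le_const hS.lt_top fun y _ => ?_
  rw [Real.norm_eq_abs, abs_of_nonneg (heatKernel_nonneg ht x y)]
  exact heatKernel_le ht x y

/-- The heat exchange `∫_S ∫_T p_t(x,y) dy dx`. -/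
noncomputable def heatExchange (n : ℕ) (S T : Set (𝔼 n)) (t : ℝ) : ℝ :=
  ∫ x in S, heatContent n T t x

lemma measurable_heatExchange (S T : Set (𝔼 n)) : Measurable (heatExchange n S T) :=
  (StronglyMeasurable.integral_prod_right (ν := volume.restrict S)
    (f := fun (t : ℝ) x => heatContent n T t x)
    (measurable_heatContent T).stronglyMeasurable).measurable

lemma measurable_heatContent_right (T : Set (𝔼 n)) (t : ℝ) : Measurable (heatContent n T t) :=
  (measurable_heatContent T).comp (measurable_const.prodMk measurable_id)

lemma integrableOn_heatContent {t : ℝ} (ht : 0 < t) {S : Set (𝔼 n)} (hS : volume S ≠ ⊤)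
    (T : Set (𝔼 n)) : IntegrableOn (heatContent n T t) S :=
  Measure.integrableOn_of_bounded hS (measurable_heatContent_right T t).aestronglyMeasurable
    (M := 1) (ae_of_all _ fun x => abs_heatContent_le_one ht T x)

lemma heatExchange_nonneg {t : ℝ} (ht : 0 < t) (S T : Set (𝔼 n)) : 0 ≤ heatExchange n S T t :=
  integral_nonneg fun _ => heatContent_nonneg ht _ _

lemma heatExchange_le {t : ℝ} (ht : 0 < t) {S : Set (𝔼 n)} (hS : volume S ≠ ⊤)
    (T : Set (𝔼 n)) : heatExchange n S T t ≤ volume.real S := by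
  have h := norm_setIntegral_le_of_norm_le_const (f := heatContent n T t) (C := 1) hS.lt_top
    (fun x _ => abs_heatContent_le_one ht T x)
  rw [one_mul] at h
  exact (le_abs_self _).trans h

lemma ofReal_heatExchange {t : ℝ} (ht : 0 < t) {S : Set (𝔼 n)} (hS : volume S ≠ ⊤)
    (T : Set (𝔼 n)) :
    ENNReal.ofReal (heatExchange n S T t) =
      ∫⁻ x in S, ∫⁻ y in T, ENNReal.ofReal (heatKernel n t x y) := by
  rw [heatExchange, ofReal_integral_eq_lintegral_ofReal (integrableOn_heatContent ht hS T)
    (ae_of_all _ fun _ => heatContent_nonneg ht _ _)]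
  simp_rw [ofReal_heatContent ht]

lemma lintegral_heatKernel_swap (t : ℝ) (S T : Set (𝔼 n)) :
    ∫⁻ x in S, ∫⁻ y in T, ENNReal.ofReal (heatKernel n t x y) =
      ∫⁻ x in T, ∫⁻ y in S, ENNReal.ofReal (heatKernel n t x y) := by
  rw [lintegral_lintegral_swap]
  · simp_rw [heatKernel_symm t]
  · exact (measurable_heatKernel.comp
      ((measurable_const.prodMk measurable_fst).prodMk measurable_snd)).ennreal_ofReal.aemeasurable

/-- For large times the heat exchange only sees the mass of the bounded set. -/
lemma tendsto_heatExchange_sub {S : Set (𝔼 n)} (hS : volume S ≠ ⊤) (T : Set (𝔼 n)) :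
    Tendsto (fun t => heatExchange n S T t - volume.real S * heatContent n T t 0)
      atTop (𝓝 0) := by
  have key := tendsto_integral_filter_of_dominated_convergence (μ := volume.restrict S)
    (l := atTop) (F := fun t x => heatContent n T t x - heatContent n T t 0)
    (f := fun _ : 𝔼 n => (0 : ℝ)) (fun _ => 2)
    (Eventually.of_forall fun t =>
      ((measurable_heatContent_right T t).sub_const _).aestronglyMeasurable)
    ?_ (integrableOn_const hS) (ae_of_all _ fun x => tendsto_heatContent_sub T x 0)
  · rw [integral_zero] at key
    refine key.congr' ?_
    filter_upwards [eventually_gt_atTop 0] with t ht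
    rw [integral_sub (integrableOn_heatContent ht hS T) (integrableOn_const hS),
      setIntegral_const, smul_eq_mul, heatExchange]
  · filter_upwards [eventually_gt_atTop 0] with t ht
    refine ae_of_all _ fun x => (norm_sub_le _ _).trans ?_
    rw [Real.norm_eq_abs, Real.norm_eq_abs]
    linarith [abs_heatContent_le_one ht T x, abs_heatContent_le_one ht T 0]

end HeatKernel

section TimeAverage

/-- The average of `F` over `(1,∞)` with weight `s t^{-(1+s)}`. -/
noncomputable def timeAvg (F : ℝ → ℝ) (s : ℝ) : ℝ :=
  ∫ t in Ioi (1 : ℝ), s * t ^ (-(1 + s)) * F t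

lemma integrableOn_timeWeight {s : ℝ} (hs : 0 < s) :
    IntegrableOn (fun t : ℝ => s * t ^ (-(1 + s))) (Ioi 1) :=
  (integrableOn_Ioi_rpow_of_lt (by linarith) one_pos).const_mul s

lemma integral_timeWeight {s : ℝ} (hs : 0 < s) :
    ∫ t in Ioi (1 : ℝ), s * t ^ (-(1 + s)) = 1 := by
  rw [integral_const_mul, integral_Ioi_rpow_of_lt (by linarith) one_pos, Real.one_rpow]
  have : -(1 + s) + 1 = -s := by ring
  rw [this]
  field_simp

lemma timeWeight_nonneg {s t : ℝ} (hs : 0 < s) (ht : 1 < t) : 0 ≤ s * t ^ (-(1 + s)) := by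
  positivity

variable {F G : ℝ → ℝ} {C D : ℝ}

lemma integrableOn_timeWeight_mul {s : ℝ} (hs : 0 < s) (hF : Measurable F)
    (hFC : ∀ t, 1 < t → |F t| ≤ C) :
    IntegrableOn (fun t : ℝ => s * t ^ (-(1 + s)) * F t) (Ioi 1) :=
  (integrableOn_timeWeight hs).mul_bdd hF.aestronglyMeasurable
    ((ae_restrict_iff' measurableSet_Ioi).2 (ae_of_all _ hFC))

lemma timeAvg_nonneg {s : ℝ} (hs : 0 < s) (hF : ∀ t, 1 < t → 0 ≤ F t) : 0 ≤ timeAvg F s :=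
  setIntegral_nonneg measurableSet_Ioi fun t ht => mul_nonneg (timeWeight_nonneg hs ht) (hF t ht)

lemma timeAvg_le {s : ℝ} (hs : 0 < s) (hF : Measurable F) (hFC : ∀ t, 1 < t → |F t| ≤ C) :
    timeAvg F s ≤ C := by
  calc timeAvg F s ≤ ∫ t in Ioi (1 : ℝ), s * t ^ (-(1 + s)) * C :=
        setIntegral_mono_on (integrableOn_timeWeight_mul hs hF hFC)
          ((integrableOn_timeWeight hs).mul_const C) measurableSet_Ioi fun t ht =>
          mul_le_mul_of_nonneg_left ((le_abs_self _).trans (hFC t ht)) (timeWeight_nonneg hs ht)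
    _ = C := by rw [integral_mul_const, integral_timeWeight hs, one_mul]

lemma tendsto_timeAvg_zero (hFC : ∀ t, 1 < t → |F t| ≤ C)
    (hlim : Tendsto F atTop (𝓝 0)) : Tendsto (timeAvg F) (𝓝[>] 0) (𝓝 0) := by
  have hC : 0 ≤ C := (abs_nonneg _).trans (hFC 2 one_lt_two)
  rw [Metric.tendsto_nhds]
  intro ε hε
  obtain ⟨T, hT⟩ := (Metric.tendsto_atTop.1 hlim) (ε / 2) (by positivity)
  set R := max T 1 with hR
  have hR1 : 1 ≤ R := le_max_right _ _
  have hsmall : ∀ᶠ s : ℝ in 𝓝[>] 0, s * (C * (R - 1)) < ε / 2 := by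
    have h : Tendsto (fun s : ℝ => s * (C * (R - 1))) (𝓝[>] 0) (𝓝 0) := by
      have h' : Tendsto (fun s : ℝ => s * (C * (R - 1))) (𝓝 0) (𝓝 (0 * (C * (R - 1)))) :=
        tendsto_id.mul_const _
      rw [zero_mul] at h'
      exact h'.mono_left nhdsWithin_le_nhds
    exact h.eventually_lt_const (by positivity)
  filter_upwards [hsmall, self_mem_nhdsWithin] with s hs hs0
  have hs0 : 0 < s := hs0
  have hind : IntegrableOn ((Ioc 1 R).indicator fun _ => s * C) (Ioi 1) :=
    ((integrableOn_const (by simp) : IntegrableOn (fun _ => s * C) (Ioc 1 R)).integrable_indicator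
      measurableSet_Ioc).integrableOn
  have hw : IntegrableOn (fun t : ℝ => s * t ^ (-(1 + s)) * (ε / 2)) (Ioi 1) :=
    (integrableOn_timeWeight hs0).mul_const _
  have hbound : ‖timeAvg F s‖ ≤
      ∫ t in Ioi (1 : ℝ), ((Ioc 1 R).indicator (fun _ => s * C) t
        + s * t ^ (-(1 + s)) * (ε / 2)) := by
    refine norm_integral_le_of_norm_le (hind.add hw)
      ((ae_restrict_iff' measurableSet_Ioi).2 (ae_of_all _ fun t (ht : 1 < t) => ?_))
    have hw0 := timeWeight_nonneg hs0 ht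
    rw [norm_mul, Real.norm_eq_abs, Real.norm_eq_abs, abs_of_nonneg hw0]
    by_cases htR : t ≤ R
    · rw [indicator_of_mem (show t ∈ Ioc 1 R from ⟨ht, htR⟩)]
      have h1 : t ^ (-(1 + s)) ≤ 1 := Real.rpow_le_one_of_one_le_of_nonpos ht.le (by linarith)
      have h2 : s * t ^ (-(1 + s)) * |F t| ≤ s * 1 * C := by
        gcongr
        exact hFC t ht
      have h3 : 0 ≤ s * t ^ (-(1 + s)) * (ε / 2) := by positivity
      linarith
    · rw [indicator_of_notMem (fun h => htR h.2), zero_add]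
      have h1 := hT t ((le_max_left _ _).trans (not_le.1 htR).le)
      rw [dist_zero_right, Real.norm_eq_abs] at h1
      gcongr
  rw [integral_add hind hw, integral_mul_const, integral_timeWeight hs0,
    setIntegral_indicator measurableSet_Ioc,
    inter_eq_right.2 (Ioc_subset_Ioi_self), setIntegral_const, Real.volume_real_Ioc_of_le hR1,
    smul_eq_mul] at hbound
  rw [dist_zero_right]
  nlinarith

lemma timeAvg_sub {s : ℝ} (hs : 0 < s) (hF : Measurable F) (hFC : ∀ t, 1 < t → |F t| ≤ C)
    (hG : Measurable G) (hGD : ∀ t, 1 < t → |G t| ≤ D) :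
    timeAvg (fun t => F t - G t) s = timeAvg F s - timeAvg G s := by
  simp_rw [timeAvg, mul_sub]
  exact integral_sub (integrableOn_timeWeight_mul hs hF hFC)
    (integrableOn_timeWeight_mul hs hG hGD)

lemma timeAvg_const_add_mul {s : ℝ} (hs : 0 < s) (hF : Measurable F)
    (hFC : ∀ t, 1 < t → |F t| ≤ C) (a b : ℝ) :
    timeAvg (fun t => a + b * F t) s = a + b * timeAvg F s := by
  have h : ∀ t, s * t ^ (-(1 + s)) * (a + b * F t) =
      s * t ^ (-(1 + s)) * a + b * (s * t ^ (-(1 + s)) * F t) := fun t => by ring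
  simp_rw [timeAvg, h]
  rw [integral_add ((integrableOn_timeWeight hs).mul_const a)
    ((integrableOn_timeWeight_mul hs hF hFC).const_mul b), integral_mul_const,
    integral_timeWeight hs, one_mul, integral_const_mul]

lemma tendsto_timeAvg_sub (hF : Measurable F) (hFC : ∀ t, 1 < t → |F t| ≤ C)
    (hG : Measurable G) (hGD : ∀ t, 1 < t → |G t| ≤ D)
    (hlim : Tendsto (fun t => F t - G t) atTop (𝓝 0)) :
    Tendsto (fun s => timeAvg F s - timeAvg G s) (𝓝[>] 0) (𝓝 0) := by
  have hb : ∀ t, 1 < t → |F t - G t| ≤ C + D := fun t ht =>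
    (abs_sub _ _).trans (add_le_add (hFC t ht) (hGD t ht))
  refine (tendsto_timeAvg_zero hb hlim).congr' ?_
  filter_upwards [self_mem_nhdsWithin] with s hs
  exact timeAvg_sub hs hF hFC hG hGD

lemma ofReal_timeAvg {s : ℝ} (hs : 0 < s) (hF : Measurable F) (hFC : ∀ t, 1 < t → |F t| ≤ C)
    (hF0 : ∀ t, 1 < t → 0 ≤ F t) {Φ : ℝ → ℝ≥0∞}
    (hΦ : ∀ t, 1 < t → Φ t = ENNReal.ofReal (F t)) :
    ENNReal.ofReal s * ∫⁻ t in Ioi (1 : ℝ), ENNReal.ofReal (t ^ (-(1 + s))) * Φ t =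
      ENNReal.ofReal (timeAvg F s) := by
  rw [timeAvg, ofReal_integral_eq_lintegral_ofReal (integrableOn_timeWeight_mul hs hF hFC)
    ((ae_restrict_iff' measurableSet_Ioi).2 (ae_of_all _ fun t ht =>
      mul_nonneg (timeWeight_nonneg hs ht) (hF0 t ht))),
    ← lintegral_const_mul' _ _ ENNReal.ofReal_ne_top]
  refine setLIntegral_congr_fun measurableSet_Ioi fun t ht => ?_
  have ht : 1 < t := ht
  rw [hΦ t ht, ENNReal.ofReal_mul (timeWeight_nonneg hs ht), ENNReal.ofReal_mul hs.le, mul_assoc]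

lemma tendsto_small_time {Φ : ℝ → ℝ≥0∞} {s₀ : ℝ} (hs₀ : 0 < s₀)
    (hfin : ∫⁻ t in Ioi (0 : ℝ), ENNReal.ofReal (t ^ (-(1 + s₀))) * Φ t ≠ ⊤) :
    Tendsto (fun s : ℝ => ENNReal.ofReal s *
      ∫⁻ t in Ioc (0 : ℝ) 1, ENNReal.ofReal (t ^ (-(1 + s))) * Φ t) (𝓝[>] 0) (𝓝 0) := by
  set I := ∫⁻ t in Ioi (0 : ℝ), ENNReal.ofReal (t ^ (-(1 + s₀))) * Φ t
  have hlim : Tendsto (fun s : ℝ => ENNReal.ofReal s * I) (𝓝[>] 0) (𝓝 0) := by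
    have h := ENNReal.Tendsto.mul_const (b := I)
      (ENNReal.tendsto_ofReal (tendsto_id (α := ℝ) (x := 𝓝 0))) (Or.inr hfin)
    simp only [ENNReal.ofReal_zero, zero_mul, id] at h
    exact h.mono_left nhdsWithin_le_nhds
  refine tendsto_of_tendsto_of_tendsto_of_le_of_le' tendsto_const_nhds hlim
    (Eventually.of_forall fun _ => zero_le) ?_
  filter_upwards [Ioo_mem_nhdsGT hs₀] with s hs
  gcongr
  refine (setLIntegral_mono' measurableSet_Ioc fun t ht => ?_).trans
    (lintegral_mono_set Ioc_subset_Ioi_self)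
  gcongr ENNReal.ofReal ?_ * _
  exact Real.rpow_le_rpow_of_exponent_ge ht.1 ht.2 (by linarith [hs.2])

end TimeAverage

lemma exists_tendsto_iff_toReal {u : ℝ → ℝ≥0∞} {l : Filter ℝ} [l.NeBot] {K : ℝ≥0∞} (hK : K ≠ ⊤)
    (hu : ∀ᶠ s in l, u s ≤ K) :
    (∃ P, Tendsto u l (𝓝 P)) ↔ ∃ p, Tendsto (fun s => (u s).toReal) l (𝓝 p) := by
  constructor
  · rintro ⟨P, hP⟩
    exact ⟨_, (ENNReal.tendsto_toReal ((le_of_tendsto hP hu).trans_lt hK.lt_top).ne).comp hP⟩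
  · rintro ⟨p, hp⟩
    refine ⟨_, (ENNReal.tendsto_ofReal hp).congr' ?_⟩
    filter_upwards [hu] with s hs
    exact ENNReal.ofReal_toReal (hs.trans_lt hK.lt_top).ne

section Perimeter

variable {n : ℕ}

lemma measurable_heatContent_left (S : Set (𝔼 n)) (x : 𝔼 n) :
    Measurable fun t => heatContent n S t x :=
  (measurable_heatContent S).comp
    ((measurable_id (α := ℝ)).prodMk (measurable_const (a := x)))

lemma ofReal_mul_LambdaE (E : Set (𝔼 n)) (x : 𝔼 n) (r : ℝ) {s : ℝ} (hs : 0 < s) :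
    ENNReal.ofReal s * LambdaE n E x r s =
      ENNReal.ofReal (timeAvg (fun t => heatContent n (E \ Metric.ball x r) t x) s) :=
  ofReal_timeAvg hs (measurable_heatContent_left _ x)
    (fun _ ht => abs_heatContent_le_one (one_pos.trans ht) _ x)
    (fun _ ht => heatContent_nonneg (one_pos.trans ht) _ x)
    fun _ ht => (ofReal_heatContent (one_pos.trans ht) _ x).symm

/-- Neither the centre nor the radius of the excised ball matters as `s → 0⁺`. -/
lemma tendsto_toReal_LambdaE_sub (hn : 1 ≤ n) {E : Set (𝔼 n)} (hE : MeasurableSet E)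
    (x : 𝔼 n) (r : ℝ) :
    Tendsto (fun s => (ENNReal.ofReal s * LambdaE n E x r s).toReal -
      timeAvg (fun t => heatContent n E t 0) s) (𝓝[>] 0) (𝓝 0) := by
  have hlim : Tendsto
      (fun t => heatContent n (E \ Metric.ball x r) t x - heatContent n E t 0) atTop (𝓝 0) := by
    have hball : volume (E ∩ Metric.ball x r) ≠ ⊤ :=
      ((measure_mono inter_subset_right).trans_lt measure_ball_lt_top).ne
    have h := (tendsto_heatContent_sub E x 0).sub
      (tendsto_heatContent_of_volume_ne_top hn hball x)
    rw [sub_zero] at h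
    refine h.congr' ?_
    filter_upwards [eventually_gt_atTop 0] with t ht
    have hu := heatContent_union ht (disjoint_sdiff_inter (s := E) (t := Metric.ball x r))
      (hE.inter measurableSet_ball) x
    rw [sdiff_union_inter] at hu
    linarith
  refine (tendsto_timeAvg_sub (measurable_heatContent_left _ x)
    (fun _ ht => abs_heatContent_le_one (one_pos.trans ht) _ x)
    (measurable_heatContent_left _ 0)
    (fun _ ht => abs_heatContent_le_one (one_pos.trans ht) _ 0) hlim).congr' ?_
  filter_upwards [self_mem_nhdsWithin] with s hs
  rw [ofReal_mul_LambdaE E x r hs, ENNReal.toReal_ofReal (timeAvg_nonneg hs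
    fun _ ht => heatContent_nonneg (one_pos.trans ht) _ x)]

lemma ofReal_mul_LambdaE_le_one (E : Set (𝔼 n)) (x : 𝔼 n) (r : ℝ) {s : ℝ} (hs : 0 < s) :
    ENNReal.ofReal s * LambdaE n E x r s ≤ 1 := by
  rw [ofReal_mul_LambdaE E x r hs, ENNReal.ofReal_le_one]
  exact timeAvg_le hs (measurable_heatContent_left _ x)
    (fun _ ht => abs_heatContent_le_one (one_pos.trans ht) _ x)

/-- The integrand in time of `Per_s(E,Ω) / 2`. -/
noncomputable def perimeterFlux (n : ℕ) (E Ω : Set (𝔼 n)) (t : ℝ) : ℝ≥0∞ :=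
  (∫⁻ x in E ∩ Ω, ∫⁻ y in Eᶜ ∩ Ω, ENNReal.ofReal (heatKernel n t x y)) +
    (∫⁻ x in E ∩ Ω, ∫⁻ y in Eᶜ ∩ Ωᶜ, ENNReal.ofReal (heatKernel n t x y)) +
    ∫⁻ x in E ∩ Ωᶜ, ∫⁻ y in Eᶜ ∩ Ω, ENNReal.ofReal (heatKernel n t x y)

lemma measurable_lintegral_heatKernel (S T : Set (𝔼 n)) :
    Measurable fun t => ∫⁻ x in S, ∫⁻ y in T, ENNReal.ofReal (heatKernel n t x y) :=
  Measurable.lintegral_prod_right' (ν := volume.restrict S)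
    (f := fun p : ℝ × (𝔼 n) => ∫⁻ y in T, ENNReal.ofReal (heatKernel n p.1 p.2 y))
    (Measurable.lintegral_prod_right' (ν := volume.restrict T)
      (f := fun p : (ℝ × (𝔼 n)) × (𝔼 n) => ENNReal.ofReal (heatKernel n p.1.1 p.1.2 p.2))
      measurable_heatKernel.ennreal_ofReal)

lemma sPer_eq_lintegral_perimeterFlux (s : ℝ) (E Ω : Set (𝔼 n)) :
    sPer n s E Ω =
      2 * ∫⁻ t in Ioi (0 : ℝ), ENNReal.ofReal (t ^ (-(1 + s))) * perimeterFlux n E Ω t := by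
  have hw : ∀ S T : Set (𝔼 n), Measurable fun t : ℝ => ENNReal.ofReal (t ^ (-(1 + s))) *
      ∫⁻ x in S, ∫⁻ y in T, ENNReal.ofReal (heatKernel n t x y) := fun S T =>
    Measurable.mul (by fun_prop) (measurable_lintegral_heatKernel S T)
  simp_rw [sPer, Lfun, perimeterFlux, mul_add (ENNReal.ofReal _)]
  refine congrArg (2 * ·) (Eq.symm ?_)
  exact (lintegral_add_left ((hw _ _).add (hw _ _)) _).trans
    (congrArg (· + _) (lintegral_add_left (hw _ _) _))

/-- The real-valued form of `perimeterFlux`, integrating over the parts of `Ω` first. -/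
noncomputable def realFlux (n : ℕ) (E Ω : Set (𝔼 n)) (t : ℝ) : ℝ :=
  heatExchange n (E ∩ Ω) (Eᶜ ∩ Ω) t + heatExchange n (E ∩ Ω) (Eᶜ ∩ Ωᶜ) t +
    heatExchange n (Eᶜ ∩ Ω) (E ∩ Ωᶜ) t

variable {E Ω : Set (𝔼 n)}

lemma measurable_realFlux : Measurable (realFlux n E Ω) :=
  ((measurable_heatExchange _ _).add (measurable_heatExchange _ _)).add
    (measurable_heatExchange _ _)

lemma realFlux_nonneg {t : ℝ} (ht : 0 < t) : 0 ≤ realFlux n E Ω t :=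
  add_nonneg (add_nonneg (heatExchange_nonneg ht _ _) (heatExchange_nonneg ht _ _))
    (heatExchange_nonneg ht _ _)

lemma volume_inter_ne_top (hΩ : volume Ω ≠ ⊤) (S : Set (𝔼 n)) : volume (S ∩ Ω) ≠ ⊤ :=
  measure_ne_top_of_subset inter_subset_right hΩ

lemma abs_realFlux_le (hΩ : volume Ω ≠ ⊤) {t : ℝ} (ht : 0 < t) :
    |realFlux n E Ω t| ≤
      volume.real (E ∩ Ω) + volume.real (E ∩ Ω) + volume.real (Eᶜ ∩ Ω) := by
  rw [abs_of_nonneg (realFlux_nonneg ht)]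
  exact add_le_add (add_le_add (heatExchange_le ht (volume_inter_ne_top hΩ _) _)
    (heatExchange_le ht (volume_inter_ne_top hΩ _) _))
    (heatExchange_le ht (volume_inter_ne_top hΩ _) _)

lemma perimeterFlux_eq (hΩ : volume Ω ≠ ⊤) {t : ℝ} (ht : 0 < t) :
    perimeterFlux n E Ω t = ENNReal.ofReal (realFlux n E Ω t) := by
  rw [perimeterFlux, realFlux, ENNReal.ofReal_add
    (add_nonneg (heatExchange_nonneg ht _ _) (heatExchange_nonneg ht _ _))
    (heatExchange_nonneg ht _ _),
    ENNReal.ofReal_add (heatExchange_nonneg ht _ _) (heatExchange_nonneg ht _ _),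
    ofReal_heatExchange ht (volume_inter_ne_top hΩ _),
    ofReal_heatExchange ht (volume_inter_ne_top hΩ _),
    ofReal_heatExchange ht (volume_inter_ne_top hΩ _), lintegral_heatKernel_swap t (E ∩ Ωᶜ)]

lemma tendsto_realFlux_sub (hn : 1 ≤ n) (hΩo : MeasurableSet Ω) (hΩ : volume Ω ≠ ⊤)
    (hE : MeasurableSet E) :
    Tendsto (fun t => realFlux n E Ω t - (volume.real (E ∩ Ω) +
      (volume.real (Eᶜ ∩ Ω) - volume.real (E ∩ Ω)) * heatContent n E t 0)) atTop (𝓝 0) := by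
  set a := volume.real (E ∩ Ω)
  set b := volume.real (Eᶜ ∩ Ω)
  have hA := volume_inter_ne_top hΩ E
  have hB := volume_inter_ne_top hΩ Eᶜ
  have h := (((tendsto_heatExchange_sub hA (Eᶜ ∩ Ω)).add
    (tendsto_heatExchange_sub hA (Eᶜ ∩ Ωᶜ))).add
    (tendsto_heatExchange_sub hB (E ∩ Ωᶜ))).sub
    ((tendsto_heatContent_of_volume_ne_top hn hA 0).const_mul b)
  simp only [add_zero, mul_zero, sub_zero] at h
  refine h.congr' ?_
  filter_upwards [eventually_gt_atTop 0] with t ht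
  have h1 := heatContent_union ht (S := E) disjoint_compl_right hE.compl 0
  rw [union_compl_self, heatContent_univ ht] at h1
  have h2 : ∀ S : Set (𝔼 n), MeasurableSet S →
      heatContent n S t 0 = heatContent n (S ∩ Ω) t 0 + heatContent n (S ∩ Ωᶜ) t 0 := by
    intro S hS
    rw [← heatContent_union ht (disjoint_compl_right.mono inter_subset_right inter_subset_right)
      (hS.inter hΩo.compl), inter_union_compl]
  have h3 := h2 E hE
  have h4 := h2 Eᶜ hE.compl
  have h5 : heatContent n (Eᶜ ∩ Ω) t 0 + heatContent n (Eᶜ ∩ Ωᶜ) t 0 =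
      1 - heatContent n E t 0 := by linarith
  have h6 : heatContent n (E ∩ Ωᶜ) t 0 = heatContent n E t 0 - heatContent n (E ∩ Ω) t 0 := by
    linarith
  rw [realFlux, h6]
  linear_combination -a * h5

lemma ofReal_mul_sPer (hΩ : volume Ω ≠ ⊤) {s : ℝ} (hs : 0 < s) :
    ENNReal.ofReal s * sPer n s E Ω =
      2 * (ENNReal.ofReal s * (∫⁻ t in Ioc (0 : ℝ) 1,
        ENNReal.ofReal (t ^ (-(1 + s))) * perimeterFlux n E Ω t) +
        ENNReal.ofReal (timeAvg (realFlux n E Ω) s)) := by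
  rw [← ofReal_timeAvg hs measurable_realFlux
    (fun _ ht => abs_realFlux_le hΩ (one_pos.trans ht))
    (fun _ ht => realFlux_nonneg (one_pos.trans ht))
    (fun _ ht => perimeterFlux_eq hΩ (one_pos.trans ht)), ← mul_add,
    ← lintegral_union measurableSet_Ioi (Set.disjoint_left.2 fun _ h h' => not_lt.2 h.2 h'),
    Ioc_union_Ioi_eq_Ioi zero_le_one, sPer_eq_lintegral_perimeterFlux, mul_left_comm]

variable {s₀ : ℝ}

lemma tendsto_sPer_small_time (hs₀ : 0 < s₀) (hfin : sPer n s₀ E Ω < ⊤) :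
    Tendsto (fun s : ℝ => ENNReal.ofReal s * ∫⁻ t in Ioc (0 : ℝ) 1,
      ENNReal.ofReal (t ^ (-(1 + s))) * perimeterFlux n E Ω t) (𝓝[>] 0) (𝓝 0) := by
  refine tendsto_small_time hs₀ fun h => ?_
  rw [sPer_eq_lintegral_perimeterFlux, h] at hfin
  simp at hfin

lemma exists_eventually_ofReal_mul_sPer_le (hΩ : volume Ω ≠ ⊤) (hs₀ : 0 < s₀)
    (hfin : sPer n s₀ E Ω < ⊤) :
    ∃ K : ℝ≥0∞, K ≠ ⊤ ∧ ∀ᶠ s in 𝓝[>] (0 : ℝ), ENNReal.ofReal s * sPer n s E Ω ≤ K := by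
  refine ⟨2 * (1 + ENNReal.ofReal
    (volume.real (E ∩ Ω) + volume.real (E ∩ Ω) + volume.real (Eᶜ ∩ Ω))), by finiteness, ?_⟩
  filter_upwards [self_mem_nhdsWithin,
    (tendsto_sPer_small_time hs₀ hfin).eventually_lt_const one_pos] with s hs h1
  rw [ofReal_mul_sPer hΩ hs]
  gcongr
  exact timeAvg_le hs measurable_realFlux fun _ ht => abs_realFlux_le hΩ (one_pos.trans ht)

/-- The asymptotics of `s Per_s(E,Ω)` in terms of the averaged heat content of `E`. -/
lemma tendsto_toReal_sPer_sub (hn : 1 ≤ n) (hΩo : MeasurableSet Ω) (hΩ : volume Ω ≠ ⊤)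
    (hE : MeasurableSet E) (hs₀ : 0 < s₀) (hfin : sPer n s₀ E Ω < ⊤) :
    Tendsto (fun s => (ENNReal.ofReal s * sPer n s E Ω).toReal - 2 * (volume.real (E ∩ Ω) +
      (volume.real (Eᶜ ∩ Ω) - volume.real (E ∩ Ω)) *
        timeAvg (fun t => heatContent n E t 0) s)) (𝓝[>] 0) (𝓝 0) := by
  set a := volume.real (E ∩ Ω)
  set b := volume.real (Eᶜ ∩ Ω)
  have hG : ∀ t, 1 < t → |a + (b - a) * heatContent n E t 0| ≤ |a| + |b - a| * 1 :=
    fun t ht => (abs_add_le _ _).trans (by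
      rw [abs_mul]
      gcongr
      exact abs_heatContent_le_one (one_pos.trans ht) _ _)
  have hlarge := tendsto_timeAvg_sub measurable_realFlux
    (fun _ ht => abs_realFlux_le hΩ (one_pos.trans ht))
    (((measurable_heatContent_left E 0).const_mul (b - a)).const_add a) hG
    (tendsto_realFlux_sub hn hΩo hΩ hE)
  have hsmall := tendsto_sPer_small_time hs₀ hfin
  have h := ((((ENNReal.tendsto_toReal ENNReal.zero_ne_top).comp hsmall).add hlarge).const_mul 2)
  simp only [ENNReal.toReal_zero, add_zero, mul_zero] at h
  refine h.congr' ?_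
  filter_upwards [self_mem_nhdsWithin, hsmall.eventually_lt_const one_pos] with s hs h1
  rw [ofReal_mul_sPer hΩ hs, ENNReal.toReal_mul,
    ENNReal.toReal_add (h1.trans ENNReal.one_lt_top).ne ENNReal.ofReal_ne_top,
    ENNReal.toReal_ofReal (timeAvg_nonneg hs fun _ ht => realFlux_nonneg (one_pos.trans ht)),
    timeAvg_const_add_mul hs (measurable_heatContent_left E 0)
      (fun _ ht => abs_heatContent_le_one (one_pos.trans ht) _ _), ENNReal.toReal_ofNat,
    Function.comp_apply]
  ring

end Perimeter

/-- unbalanced measure case: under the collar bound, if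
`𝓛ⁿ(E∩Ω) ≠ 𝓛ⁿ(Eᶜ∩Ω)`, then `lim_{s→0⁺} s Per_s(E,Ω)` exists iff
`Ξ_E = lim_{s→0⁺} s Λ_E(x,r,s)` exists for some `x, r > 0`; and in that case
`Ξ_E = (lim_{s→0⁺} s Per_s(E,Ω) − 2𝓛ⁿ(E∩Ω)) / (2(𝓛ⁿ(Eᶜ∩Ω) − 𝓛ⁿ(E∩Ω)))`. -/
theorem statement16 (n : ℕ) (hn : 1 ≤ n) (Ω : Set (EuclideanSpace ℝ (Fin n)))
    (hΩo : IsOpen Ω) (hΩb : Bornology.IsBounded Ω)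
    (E : Set (EuclideanSpace ℝ (Fin n))) (hE : MeasurableSet E)
    (s₀ : ℝ) (hs₀ : s₀ ∈ Set.Ioo (0:ℝ) (1/2)) (hfin : sPer n s₀ E Ω < ⊤)
    (c : ℝ) (hc : 0 < c) (η : ℝ) (hη : 2 * s₀ < η)
    (hbd : ∀ r ∈ Set.Icc (0:ℝ) 1,
      volume (innerCollar n Ω r) ≤ ENNReal.ofReal (c * min (r ^ η) 1))
    (hunbal : volume (E ∩ Ω) ≠ volume (Eᶜ ∩ Ω)) :
    ((∃ P : ℝ≥0∞, Tendsto (fun s : ℝ => ENNReal.ofReal s * sPer n s E Ω)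
          (𝓝[>] (0:ℝ)) (𝓝 P)) ↔
        ∃ Ξ : ℝ≥0∞, ∃ x : EuclideanSpace ℝ (Fin n), ∃ r : ℝ, 0 < r ∧
          Tendsto (fun s : ℝ => ENNReal.ofReal s * LambdaE n E x r s)
            (𝓝[>] (0:ℝ)) (𝓝 Ξ)) ∧
      ∀ (P Ξ : ℝ≥0∞) (x : EuclideanSpace ℝ (Fin n)) (r : ℝ), 0 < r →
        Tendsto (fun s : ℝ => ENNReal.ofReal s * sPer n s E Ω) (𝓝[>] (0:ℝ)) (𝓝 P) →
        Tendsto (fun s : ℝ => ENNReal.ofReal s * LambdaE n E x r s) (𝓝[>] (0:ℝ)) (𝓝 Ξ) →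
        Ξ.toReal = (P.toReal - 2 * (volume (E ∩ Ω)).toReal) /
          (2 * ((volume (Eᶜ ∩ Ω)).toReal - (volume (E ∩ Ω)).toReal)) := by
  have hΩ : volume Ω ≠ ⊤ := hΩb.measure_lt_top.ne
  set a := volume.real (E ∩ Ω) with ha
  set b := volume.real (Eᶜ ∩ Ω) with hb
  have hab : b - a ≠ 0 := by
    rw [sub_ne_zero]
    intro h
    exact hunbal ((ENNReal.toReal_eq_toReal_iff' (volume_inter_ne_top hΩ _)
      (volume_inter_ne_top hΩ _)).1 h.symm)
  have hper := tendsto_toReal_sPer_sub hn hΩo.measurableSet hΩ hE hs₀.1 hfin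
  rw [← ha, ← hb] at hper
  have hlam := tendsto_toReal_LambdaE_sub hn hE
  obtain ⟨K, hK, hperK⟩ := exists_eventually_ofReal_mul_sPer_le hΩ hs₀.1 hfin
  have hlamK : ∀ x r, ∀ᶠ s in 𝓝[>] (0 : ℝ), ENNReal.ofReal s * LambdaE n E x r s ≤ 1 :=
    fun x r => by
      filter_upwards [self_mem_nhdsWithin] with s hs
      exact ofReal_mul_LambdaE_le_one E x r hs
  have lam_of_per : ∀ p x r, Tendsto (fun s => (ENNReal.ofReal s * sPer n s E Ω).toReal)
      (𝓝[>] (0 : ℝ)) (𝓝 p) →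
      Tendsto (fun s => (ENNReal.ofReal s * LambdaE n E x r s).toReal) (𝓝[>] (0 : ℝ))
        (𝓝 ((p - 2 * a) / (2 * (b - a)))) := by
    intro p x r hp
    have h := (hlam x r).add (((hp.sub hper).sub_const (2 * a)).div_const (2 * (b - a)))
    rw [zero_add, sub_zero] at h
    refine h.congr fun s => ?_
    field_simp
    ring
  have per_of_lam : ∀ q x r, Tendsto (fun s => (ENNReal.ofReal s * LambdaE n E x r s).toReal)
      (𝓝[>] (0 : ℝ)) (𝓝 q) →
      ∃ p, Tendsto (fun s => (ENNReal.ofReal s * sPer n s E Ω).toReal)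
        (𝓝[>] (0 : ℝ)) (𝓝 p) := by
    intro q x r hq
    refine ⟨_, (hper.add (((hq.sub (hlam x r)).const_mul (2 * (b - a))).add_const
      (2 * a))).congr fun s => ?_⟩
    ring
  refine ⟨⟨fun hP => ?_, ?_⟩, ?_⟩
  · obtain ⟨p, hp⟩ := (exists_tendsto_iff_toReal hK hperK).1 hP
    obtain ⟨Ξ, hΞ⟩ := (exists_tendsto_iff_toReal ENNReal.one_ne_top (hlamK 0 1)).2
      ⟨_, lam_of_per p 0 1 hp⟩
    exact ⟨Ξ, 0, 1, one_pos, hΞ⟩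
  · rintro ⟨Ξ, x, r, -, hΞ⟩
    obtain ⟨q, hq⟩ := (exists_tendsto_iff_toReal ENNReal.one_ne_top (hlamK x r)).1 ⟨Ξ, hΞ⟩
    exact (exists_tendsto_iff_toReal hK hperK).2 (per_of_lam q x r hq)
  · intro P Ξ x r _ hP hΞ
    have hPtop : P ≠ ⊤ := ((le_of_tendsto hP hperK).trans_lt hK.lt_top).ne
    have hΞtop : Ξ ≠ ⊤ := ((le_of_tendsto hΞ (hlamK x r)).trans_lt ENNReal.one_lt_top).ne
    exact tendsto_nhds_unique ((ENNReal.tendsto_toReal hΞtop).comp hΞ)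
      (lam_of_per _ x r ((ENNReal.tendsto_toReal hPtop).comp hP))
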